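/- arXiv:1003.0297 — 2 statements merged into one kernel-verified Lean document; each statement's English description precedes it below -/
import Mathlib

section
/- Let n ≥ 2 and 0 ≤ r < 1. Then the operator norm of differentiation D : K_{b_r^n} → H² on the model space of the Blaschke product b_r^n satisfies ‖D‖ ≥ (n/((1-r)(1+r)))·(1 + 5r⁴ - 4r⁴/n - min(3/4, 2/n))^{1/2}. Consequently C_{n,r} ≥ a(n,r)·n/(1-r) with a(n,r) = (1/(1+r))·(1 + 5r⁴ - 4r⁴/n - min(3/4, 2/n))^{1/2}. -/
open Complex Filter Finset MeasureTheory Metric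

noncomputable section

/-- The `k`-th Taylor coefficient of `f` at `0`. -/
def hcoeff (f : ℂ → ℂ) (k : ℕ) : ℂ := iteratedDeriv k f 0 / (Nat.factorial k : ℂ)

/-- The Hardy space `H²` norm of `f`, computed through the Taylor coefficients at `0`:
`‖f‖₂² = ∑_{k≥0} |f̂(k)|²`. -/
def h2norm (f : ℂ → ℂ) : ℝ := Real.sqrt (∑' k : ℕ, ‖hcoeff f k‖ ^ 2)

/-- Membership in the Hardy space `H²` of the unit disc: `f` is holomorphic on the unit
disc and its Taylor coefficients are square-summable. -/
def MemH2 (f : ℂ → ℂ) : Prop :=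
  DifferentiableOn ℂ f (ball 0 1) ∧ Summable (fun k : ℕ => ‖hcoeff f k‖ ^ 2)

/-- The `H²` inner product `(f,g) = ∑_{k≥0} f̂(k)·conj(ĝ(k))`. -/
def h2inner (f g : ℂ → ℂ) : ℂ := ∑' k : ℕ, hcoeff f k * (starRingEnd ℂ) (hcoeff g k)

/-- Elementary Blaschke factor `b_λ(z) = (λ - z)/(1 - conj(λ)·z)`. -/
def blaschke (l : ℂ) : ℂ → ℂ := fun z => (l - z) / (1 - (starRingEnd ℂ) l * z)

/-- Membership in the model space `K_B = H² ⊖ B·H²`: `f ∈ H²` and `f` is orthogonal to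
`B·g` for every `g ∈ H²`. -/
def MemKB (B f : ℂ → ℂ) : Prop :=
  MemH2 f ∧ ∀ g : ℂ → ℂ, MemH2 g → h2inner f (fun z => B z * g z) = 0

/-- The norm of the differentiation operator `D : K_B → H²`, `Df = f'`. -/
def DNorm (B : ℂ → ℂ) : ℝ :=
  sSup {x : ℝ | ∃ f : ℂ → ℂ, MemKB B f ∧ h2norm f ≤ 1 ∧ x = h2norm (deriv f)}

/-- `C_{n,r}`: the supremum of `‖D‖_{K_{B_σ} → H²}` over all finite sequences `σ` in the
unit disc with `1 ≤ card σ ≤ n` and `|λ| ≤ r` for all `λ ∈ σ`. -/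
def Cnr (n : ℕ) (r : ℝ) : ℝ :=
  sSup {x : ℝ | ∃ m : ℕ, 1 ≤ m ∧ m ≤ n ∧ ∃ l : Fin m → ℂ,
    (∀ j, ‖l j‖ ≤ r) ∧ x = DNorm (fun z => ∏ j, blaschke (l j) z)}

/-- The Malmquist–Walsh basis function `e_k(z) = (1-r²)^{1/2}/(1-rz) · b_r(z)^{k-1}`
of the model space `K_{b_r^n}`. -/
def mw (r : ℝ) (k : ℕ) : ℂ → ℂ :=
  fun z => (Real.sqrt (1 - r ^ 2) : ℂ) / (1 - (r : ℂ) * z) * (blaschke (r : ℂ) z) ^ (k - 1)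

open scoped Topology ComplexConjugate

lemma hcoeff_congr {f g : ℂ → ℂ} (h : f =ᶠ[𝓝 0] g) (k : ℕ) : hcoeff f k = hcoeff g k := by
  unfold hcoeff
  rw [h.iteratedDeriv_eq k]

lemma hcoeff_congr_ball {f g : ℂ → ℂ} (h : Set.EqOn f g (ball 0 1)) : hcoeff f = hcoeff g :=
  funext fun k => hcoeff_congr (h.eventuallyEq_of_mem (ball_mem_nhds 0 one_pos)) k

lemma hcoeff_deriv (f : ℂ → ℂ) (k : ℕ) : hcoeff (deriv f) k = (k + 1) * hcoeff f (k + 1) := by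
  unfold hcoeff
  rw [iteratedDeriv_succ', Nat.factorial_succ]
  have h1 : (k.factorial : ℂ) ≠ 0 := by exact_mod_cast k.factorial_ne_zero
  have h2 : (k : ℂ) + 1 ≠ 0 := by exact_mod_cast k.succ_ne_zero
  push_cast
  field_simp

lemma hcoeff_add {f g : ℂ → ℂ} (hf : AnalyticAt ℂ f 0) (hg : AnalyticAt ℂ g 0) (k : ℕ) :
    hcoeff (fun z => f z + g z) k = hcoeff f k + hcoeff g k := by
  unfold hcoeff
  rw [← add_div]
  congr 1
  exact iteratedDeriv_add hf.contDiffAt hg.contDiffAt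

lemma hcoeff_const_mul (c : ℂ) (f : ℂ → ℂ) (k : ℕ) :
    hcoeff (fun z => c * f z) k = c * hcoeff f k := by
  unfold hcoeff
  rw [iteratedDeriv_const_mul_field, mul_div_assoc]

lemma hcoeff_zero (f : ℂ → ℂ) : hcoeff f 0 = f 0 := by
  simp [hcoeff]

lemma hcoeff_id_mul_succ {f : ℂ → ℂ} (hf : AnalyticAt ℂ f 0) (k : ℕ) :
    hcoeff (fun z => z * f z) (k + 1) = hcoeff f k := by
  have h : iteratedDeriv (k + 1) (fun z => z * f z) 0 = (k + 1) * iteratedDeriv k f 0 := by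
    have := iteratedDeriv_mul (n := k + 1) (x := (0 : ℂ)) (f := fun z : ℂ => z) (g := f)
      contDiffAt_id hf.contDiffAt
    change iteratedDeriv (k + 1) ((fun z : ℂ => z) * f) 0 = _
    rw [this, Finset.sum_eq_single 1]
    · simp
    · intro i _ hi
      rw [iteratedDeriv_fun_id_zero]
      simp [hi]
    · intro h
      simp at h
  unfold hcoeff
  rw [h, Nat.factorial_succ]
  have h1 : (k.factorial : ℂ) ≠ 0 := by exact_mod_cast k.factorial_ne_zero
  have h2 : (k : ℂ) + 1 ≠ 0 := by exact_mod_cast k.succ_ne_zero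
  push_cast
  field_simp

lemma hcoeff_linear_mul_succ {f : ℂ → ℂ} (hf : AnalyticAt ℂ f 0) (a b : ℂ) (k : ℕ) :
    hcoeff (fun z => (a - b * z) * f z) (k + 1) = a * hcoeff f (k + 1) - b * hcoeff f k := by
  have e : (fun z => (a - b * z) * f z) = fun z => (a * f z) + ((-b) * (z * f z)) := by
    funext z; ring
  rw [e, hcoeff_add (by fun_prop) (by fun_prop), hcoeff_const_mul, hcoeff_const_mul,
    hcoeff_id_mul_succ hf]
  ring

lemma hcoeff_linear_mul_zero (f : ℂ → ℂ) (a b : ℂ) :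
    hcoeff (fun z => (a - b * z) * f z) 0 = a * hcoeff f 0 := by
  simp [hcoeff_zero]

lemma hcoeff_polynomial (p : Polynomial ℂ) (k : ℕ) :
    hcoeff (fun z => p.eval z) k = p.coeff k := by
  induction k generalizing p with
  | zero => rw [hcoeff_zero, Polynomial.coeff_zero_eq_eval_zero]
  | succ k ih =>
    have h := hcoeff_deriv (fun z => p.eval z) k
    have hd : deriv (fun z => p.eval z) = fun z => p.derivative.eval z :=
      funext fun z => p.deriv
    rw [hd, ih, Polynomial.coeff_derivative, mul_comm] at h
    exact (mul_left_cancel₀ (by exact_mod_cast k.succ_ne_zero) h).symm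

lemma MemH2.analyticAt {f : ℂ → ℂ} (hf : MemH2 f) : AnalyticAt ℂ f 0 :=
  hf.1.analyticAt (ball_mem_nhds 0 one_pos)

lemma MemH2.congr {f g : ℂ → ℂ} (hf : MemH2 f) (h : Set.EqOn f g (ball 0 1)) : MemH2 g :=
  ⟨hf.1.congr h.symm, hcoeff_congr_ball h ▸ hf.2⟩

lemma MemH2.const_mul {f : ℂ → ℂ} (hf : MemH2 f) (c : ℂ) : MemH2 (fun z => c * f z) := by
  refine ⟨hf.1.const_mul c, ?_⟩
  simp only [hcoeff_const_mul, norm_mul, mul_pow]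
  exact hf.2.mul_left _

lemma norm_add_sq_le_two_mul (x y : ℂ) : ‖x + y‖ ^ 2 ≤ 2 * ‖x‖ ^ 2 + 2 * ‖y‖ ^ 2 := by
  nlinarith [norm_add_le x y, norm_nonneg (x + y), norm_nonneg x, norm_nonneg y,
    sq_nonneg (‖x‖ - ‖y‖)]

lemma MemH2.add {f g : ℂ → ℂ} (hf : MemH2 f) (hg : MemH2 g) : MemH2 (fun z => f z + g z) := by
  refine ⟨hf.1.add hg.1, ?_⟩
  simp only [hcoeff_add hf.analyticAt hg.analyticAt]
  exact Summable.of_nonneg_of_le (fun _ => by positivity)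
    (fun k => norm_add_sq_le_two_mul _ _) ((hf.2.mul_left 2).add (hg.2.mul_left 2))

lemma MemH2.linear_mul {f : ℂ → ℂ} (hf : MemH2 f) (a b : ℂ) :
    MemH2 (fun z => (a - b * z) * f z) := by
  have hz : MemH2 (fun z => z * f z) := by
    refine ⟨differentiableOn_id.mul hf.1, ?_⟩
    rw [← summable_nat_add_iff 1]
    simpa only [hcoeff_id_mul_succ hf.analyticAt] using hf.2
  convert (hf.const_mul a).add (hz.const_mul (-b)) using 2 with z
  ring

lemma MemH2.polynomial (p : Polynomial ℂ) : MemH2 (fun z => p.eval z) := by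
  refine ⟨p.differentiable.differentiableOn, ?_⟩
  simp only [hcoeff_polynomial]
  refine summable_of_ne_finset_zero (s := p.support) fun k hk => ?_
  simp [Polynomial.notMem_support_iff.mp hk]

lemma MemH2.summable_mul {f g : ℂ → ℂ} (hf : MemH2 f) (hg : MemH2 g) :
    Summable fun k => hcoeff f k * conj (hcoeff g k) := by
  refine Summable.of_norm_bounded (hf.2.add hg.2) fun k => ?_
  rw [norm_mul, RCLike.norm_conj]
  nlinarith [sq_nonneg (‖hcoeff f k‖ - ‖hcoeff g k‖), norm_nonneg (hcoeff f k),
    norm_nonneg (hcoeff g k)]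

lemma h2inner_congr {f f' g g' : ℂ → ℂ} (hf : Set.EqOn f f' (ball 0 1))
    (hg : Set.EqOn g g' (ball 0 1)) : h2inner f g = h2inner f' g' := by
  unfold h2inner
  rw [hcoeff_congr_ball hf, hcoeff_congr_ball hg]

lemma h2inner_add_left {f g h : ℂ → ℂ} (hf : MemH2 f) (hg : MemH2 g) (hh : MemH2 h) :
    h2inner (fun z => f z + g z) h = h2inner f h + h2inner g h := by
  unfold h2inner
  rw [← (hf.summable_mul hh).tsum_add (hg.summable_mul hh)]
  simp only [hcoeff_add hf.analyticAt hg.analyticAt, add_mul]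

lemma h2inner_const_mul_left (c : ℂ) (f g : ℂ → ℂ) :
    h2inner (fun z => c * f z) g = c * h2inner f g := by
  unfold h2inner
  rw [← tsum_mul_left]
  simp only [hcoeff_const_mul, mul_assoc]

lemma h2inner_conj (f g : ℂ → ℂ) : conj (h2inner f g) = h2inner g f := by
  unfold h2inner
  rw [Complex.conj_tsum]
  simp [mul_comm]

lemma h2inner_self (f : ℂ → ℂ) : h2inner f f = ((h2norm f ^ 2 : ℝ) : ℂ) := by
  unfold h2inner h2norm
  rw [Real.sq_sqrt (tsum_nonneg fun _ => by positivity), Complex.ofReal_tsum]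
  simp [Complex.mul_conj, Complex.normSq_eq_norm_sq]

section Blaschke

variable {r : ℝ}

lemma one_sub_mul_ne_zero {l z : ℂ} (hl : ‖l‖ < 1) (hz : z ∈ ball (0 : ℂ) 1) :
    1 - l * z ≠ 0 := by
  intro h
  rw [mem_ball_zero_iff] at hz
  have : ‖l * z‖ = 1 := by rw [← sub_eq_zero.mp h, norm_one]
  rw [norm_mul] at this
  nlinarith [norm_nonneg l, norm_nonneg z]

lemma norm_ofReal_lt_one (hr0 : 0 ≤ r) (hr1 : r < 1) : ‖(r : ℂ)‖ < 1 := by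
  rwa [Complex.norm_real, Real.norm_of_nonneg hr0]

/-- Multiplication by the Szegő kernel `1 / (1 - r z)` preserves `H²`. -/
lemma MemH2.div_linear (hr0 : 0 ≤ r) (hr1 : r < 1) {f : ℂ → ℂ} (hf : MemH2 f) :
    MemH2 (fun z => f z / (1 - (r : ℂ) * z)) := by
  set F : ℂ → ℂ := fun z => f z / (1 - (r : ℂ) * z) with hF
  have hne : ∀ z ∈ ball (0 : ℂ) 1, 1 - (r : ℂ) * z ≠ 0 := fun z hz =>
    one_sub_mul_ne_zero (norm_ofReal_lt_one hr0 hr1) hz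
  have hd : DifferentiableOn ℂ F (ball 0 1) := hf.1.div (by fun_prop) hne
  have ha : AnalyticAt ℂ F 0 := hd.analyticAt (ball_mem_nhds 0 one_pos)
  have he : Set.EqOn (fun z => (1 - (r : ℂ) * z) * F z) f (ball 0 1) := fun z hz =>
    mul_div_cancel₀ _ (hne z hz)
  refine ⟨hd, ?_⟩
  have h1r : 0 < 1 - r := by linarith
  have h0 : hcoeff F 0 = hcoeff f 0 := by
    rw [← hcoeff_congr_ball he, hcoeff_linear_mul_zero, one_mul]
  have hs : ∀ k, hcoeff F (k + 1) = r * hcoeff F k + hcoeff f (k + 1) := fun k => by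
    rw [← hcoeff_congr_ball he, hcoeff_linear_mul_succ ha]
    ring
  have hstep : ∀ k, ‖hcoeff F (k + 1)‖ ^ 2 ≤
      r * ‖hcoeff F k‖ ^ 2 + ‖hcoeff f (k + 1)‖ ^ 2 / (1 - r) := fun k => by
    have hn : ‖hcoeff F (k + 1)‖ ≤ r * ‖hcoeff F k‖ + ‖hcoeff f (k + 1)‖ := by
      rw [hs]
      refine (norm_add_le _ _).trans_eq ?_
      rw [norm_mul, Complex.norm_real, Real.norm_of_nonneg hr0]
    have hx := norm_nonneg (hcoeff F k)
    have hy := norm_nonneg (hcoeff f (k + 1))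
    generalize ‖hcoeff F k‖ = x at *
    generalize ‖hcoeff f (k + 1)‖ = y at *
    refine (pow_le_pow_left₀ (norm_nonneg _) hn 2).trans ?_
    rw [← sub_nonneg]
    have : r * x ^ 2 + y ^ 2 / (1 - r) - (r * x + y) ^ 2
        = r * ((1 - r) * x - y) ^ 2 / (1 - r) := by
      field_simp
      ring
    rw [this]
    positivity
  have hsum : ∀ N, ∑ k ∈ range (N + 1), ‖hcoeff F k‖ ^ 2 ≤
      r * ∑ k ∈ range N, ‖hcoeff F k‖ ^ 2
        + (∑ k ∈ range (N + 1), ‖hcoeff f k‖ ^ 2) / (1 - r) := fun N => by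
    rw [sum_range_succ', sum_range_succ' (fun k => ‖hcoeff f k‖ ^ 2), h0, mul_sum, add_div,
      sum_div, ← add_assoc, ← sum_add_distrib]
    refine add_le_add (sum_le_sum fun k _ => hstep k) ?_
    rw [le_div_iff₀ h1r]
    nlinarith [sq_nonneg ‖hcoeff f 0‖]
  refine summable_of_sum_range_le
    (c := (∑' k, ‖hcoeff f k‖ ^ 2) / (1 - r) / (1 - r)) (fun _ => by positivity) fun N => ?_
  have h1 := hsum N
  have h2 : (∑ k ∈ range (N + 1), ‖hcoeff f k‖ ^ 2) / (1 - r) ≤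
      (∑' k, ‖hcoeff f k‖ ^ 2) / (1 - r) := by
    gcongr
    exact hf.2.sum_le_tsum _ fun _ _ => by positivity
  rw [sum_range_succ] at h1
  rw [le_div_iff₀ h1r]
  nlinarith [sq_nonneg ‖hcoeff F N‖]

lemma eqOn_linear_mul_div (hr0 : 0 ≤ r) (hr1 : r < 1) (f : ℂ → ℂ) :
    Set.EqOn f (fun z => (1 - (r : ℂ) * z) * (f z / (1 - (r : ℂ) * z))) (ball 0 1) := fun _ hz =>
  (mul_div_cancel₀ _ (one_sub_mul_ne_zero (norm_ofReal_lt_one hr0 hr1) hz)).symm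

lemma blaschke_mul_eq (r : ℝ) (f : ℂ → ℂ) :
    (fun z => blaschke r z * f z) = fun z => ((r : ℂ) - 1 * z) * (f z / (1 - (r : ℂ) * z)) := by
  funext z
  simp only [blaschke, conj_ofReal]
  ring

lemma MemH2.blaschke_mul (hr0 : 0 ≤ r) (hr1 : r < 1) {f : ℂ → ℂ} (hf : MemH2 f) :
    MemH2 (fun z => blaschke r z * f z) := by
  rw [blaschke_mul_eq]
  exact (hf.div_linear hr0 hr1).linear_mul _ _

/-- Multiplication by a Blaschke factor is an isometry of `H²`. -/
lemma h2inner_blaschke_mul (hr0 : 0 ≤ r) (hr1 : r < 1) {f g : ℂ → ℂ} (hf : MemH2 f)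
    (hg : MemH2 g) :
    h2inner (fun z => blaschke r z * f z) (fun z => blaschke r z * g z) = h2inner f g := by
  have hF := hf.div_linear hr0 hr1
  have hG := hg.div_linear hr0 hr1
  rw [h2inner_congr (eqOn_linear_mul_div hr0 hr1 f) (eqOn_linear_mul_div hr0 hr1 g),
    blaschke_mul_eq, blaschke_mul_eq]
  have s1 := (hF.linear_mul r 1).summable_mul (hG.linear_mul r 1)
  have s2 := (hF.linear_mul 1 r).summable_mul (hG.linear_mul 1 r)
  have s := hF.summable_mul hG
  have s' := (summable_nat_add_iff 1).mpr s
  have hs := s.tsum_eq_zero_add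
  unfold h2inner
  rw [← sub_eq_zero, ← s1.tsum_sub s2, (s1.sub s2).tsum_eq_zero_add]
  simp only [hcoeff_linear_mul_succ hF.analyticAt, hcoeff_linear_mul_succ hG.analyticAt,
    hcoeff_linear_mul_zero]
  set a := hcoeff fun z => f z / (1 - (r : ℂ) * z)
  set b := hcoeff fun z => g z / (1 - (r : ℂ) * z)
  have ht : ∀ k, ((r * a (k + 1) - 1 * a k) * conj (r * b (k + 1) - 1 * b k) -
      (1 * a (k + 1) - r * a k) * conj (1 * b (k + 1) - r * b k)) =
      ((r : ℂ) ^ 2 - 1) * (a (k + 1) * conj (b (k + 1)) - a k * conj (b k)) := fun k => by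
    simp only [map_sub, map_mul, conj_ofReal, map_one]
    ring
  simp only [ht]
  rw [tsum_mul_left, s'.tsum_sub s, hs]
  simp only [map_mul, conj_ofReal, map_one]
  ring

lemma hcoeff_szego (hr0 : 0 ≤ r) (hr1 : r < 1) (k : ℕ) :
    hcoeff (fun z => 1 / (1 - (r : ℂ) * z)) k = (r : ℂ) ^ k := by
  have h1 : MemH2 (fun _ => (1 : ℂ)) := by simpa using MemH2.polynomial 1
  have he := hcoeff_congr_ball (eqOn_linear_mul_div hr0 hr1 fun _ => 1)
  induction k with
  | zero => simp [hcoeff_zero]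
  | succ k ih =>
    have h := congrFun he (k + 1)
    have h0 : hcoeff (fun _ => (1 : ℂ)) (k + 1) = 0 := by
      simpa [Polynomial.coeff_one] using hcoeff_polynomial 1 (k + 1)
    rw [hcoeff_linear_mul_succ (h1.div_linear hr0 hr1).analyticAt, h0, ih] at h
    linear_combination -h

lemma memH2_szego (hr0 : 0 ≤ r) (hr1 : r < 1) : MemH2 (fun z => 1 / (1 - (r : ℂ) * z)) :=
  MemH2.div_linear hr0 hr1 (by simpa using MemH2.polynomial 1)

lemma h2inner_szego_self (hr0 : 0 ≤ r) (hr1 : r < 1) :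
    h2inner (fun z => 1 / (1 - (r : ℂ) * z)) (fun z => 1 / (1 - (r : ℂ) * z)) =
      ((1 - r ^ 2 : ℝ) : ℂ)⁻¹ := by
  unfold h2inner
  simp only [hcoeff_szego hr0 hr1, map_pow, conj_ofReal, ← mul_pow]
  rw [tsum_geometric_of_norm_lt_one]
  · push_cast
    ring
  · rw [norm_mul, Complex.norm_real, Real.norm_of_nonneg hr0]
    nlinarith

/-- The Szegő kernel at `r` is orthogonal to `b_r H²`. -/
lemma h2inner_szego_blaschke_mul (hr0 : 0 ≤ r) (hr1 : r < 1) {g : ℂ → ℂ} (hg : MemH2 g) :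
    h2inner (fun z => 1 / (1 - (r : ℂ) * z)) (fun z => blaschke r z * g z) = 0 := by
  have hG := hg.div_linear hr0 hr1
  have hu := memH2_szego hr0 hr1
  rw [blaschke_mul_eq]
  have s := (hu.summable_mul hG).mul_left (r : ℂ)
  have s' := (summable_nat_add_iff 1).mpr s
  unfold h2inner
  rw [(hu.summable_mul (hG.linear_mul r 1)).tsum_eq_zero_add]
  have hs := s.tsum_eq_zero_add
  simp only [hcoeff_linear_mul_succ hG.analyticAt, hcoeff_linear_mul_zero,
    hcoeff_szego hr0 hr1] at *
  set b := hcoeff fun z => g z / (1 - (r : ℂ) * z)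
  have ht : ∀ k, (r : ℂ) ^ (k + 1) * conj (r * b (k + 1) - 1 * b k) =
      r * (r ^ (k + 1) * conj (b (k + 1))) - r * (r ^ k * conj (b k)) := fun k => by
    simp only [map_sub, map_mul, conj_ofReal, map_one]
    ring
  simp only [ht]
  rw [s'.tsum_sub s, hs]
  simp only [map_mul, conj_ofReal]
  ring

/-- Pythagoras for the decomposition of `α u + b_r h`, with `u` the Szegő kernel at `r`. -/
lemma h2inner_szego_add_self (hr0 : 0 ≤ r) (hr1 : r < 1) (α : ℝ) {h : ℂ → ℂ} (hh : MemH2 h) :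
    h2inner (fun z => α * (1 / (1 - (r : ℂ) * z)) + blaschke r z * h z)
      (fun z => α * (1 / (1 - (r : ℂ) * z)) + blaschke r z * h z) =
      (α : ℂ) ^ 2 * ((1 - r ^ 2 : ℝ) : ℂ)⁻¹ + h2inner h h := by
  have hu := memH2_szego hr0 hr1
  have hb := hh.blaschke_mul hr0 hr1
  have hs := (hu.const_mul α).add hb
  have h0 := h2inner_szego_blaschke_mul hr0 hr1 hh
  have h0' : h2inner (fun z => blaschke r z * h z) (fun z => 1 / (1 - (r : ℂ) * z)) = 0 := by
    rw [← h2inner_conj, h0, map_zero]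
  rw [h2inner_add_left (hu.const_mul α) hb hs, h2inner_const_mul_left,
    ← h2inner_conj _ (fun z => 1 / (1 - (r : ℂ) * z)),
    ← h2inner_conj _ (fun z => blaschke r z * h z),
    h2inner_add_left (hu.const_mul α) hb hu, h2inner_add_left (hu.const_mul α) hb hb,
    h2inner_const_mul_left, h2inner_const_mul_left, h0, h0', h2inner_szego_self hr0 hr1,
    h2inner_blaschke_mul hr0 hr1 hh hh, map_add, map_add, h2inner_conj]
  simp only [map_mul, conj_ofReal, map_inv₀, map_zero]
  ring

lemma MemH2.blaschke_pow_mul (hr0 : 0 ≤ r) (hr1 : r < 1) (k : ℕ) {f : ℂ → ℂ} (hf : MemH2 f) :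
    MemH2 (fun z => blaschke r z ^ k * f z) := by
  induction k with
  | zero => simpa using hf
  | succ k ih =>
    convert ih.blaschke_mul hr0 hr1 using 2 with z
    ring

lemma h2inner_blaschke_pow_mul (hr0 : 0 ≤ r) (hr1 : r < 1) (k : ℕ) {f g : ℂ → ℂ} (hf : MemH2 f)
    (hg : MemH2 g) :
    h2inner (fun z => blaschke r z ^ k * f z) (fun z => blaschke r z ^ k * g z)
      = h2inner f g := by
  induction k with
  | zero => simp
  | succ k ih =>
    rw [← ih, ← h2inner_blaschke_mul hr0 hr1 (hf.blaschke_pow_mul hr0 hr1 k)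
      (hg.blaschke_pow_mul hr0 hr1 k)]
    simp only [pow_succ', mul_assoc]

end Blaschke

section Boundedness

open Polynomial in
/-- A linear functional on polynomials that annihilates the ideal generated by
`∏ (l j - X)`, `‖l j‖ ≤ r < ρ`, and is bounded on monomials decays like `ρ ^ k` on them. -/
lemma norm_functional_X_pow_le {r ρ : ℝ} (hr0 : 0 ≤ r) (hρ : r < ρ) :
    ∀ (m : ℕ) (l : Fin m → ℂ), (∀ j, ‖l j‖ ≤ r) → ∀ (ψ : ℂ[X] →ₗ[ℂ] ℂ) (A : ℝ),
      (∀ k, ‖ψ (X ^ k)‖ ≤ A) → (∀ q, ψ ((∏ j, (C (l j) - X)) * q) = 0) →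
      ∀ k, ‖ψ (X ^ k)‖ ≤ A * (1 + (r + 1) / (ρ - r)) ^ m * ρ ^ k := by
  intro m
  have hρ0 : 0 < ρ - r := by linarith
  have hρ1 : 0 ≤ ρ := by linarith
  induction m with
  | zero =>
    intro l _ ψ A hA h k
    have : ψ (X ^ k) = 0 := by simpa using h (X ^ k)
    rw [this, norm_zero]
    have : 0 ≤ A := (norm_nonneg _).trans (hA 0)
    positivity
  | succ m ih =>
    intro l hl ψ A hA h k
    have hA0 : 0 ≤ A := (norm_nonneg _).trans (hA 0)
    have happ : ∀ k, ψ (X ^ (k + 1)) = l 0 * ψ (X ^ k) + ψ ((X - C (l 0)) * X ^ k) := fun k => by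
      have : (X : ℂ[X]) ^ (k + 1) = l 0 • X ^ k + (X - C (l 0)) * X ^ k := by
        rw [smul_eq_C_mul]
        ring
      rw [this, map_add, map_smul, smul_eq_mul]
    have hψ' := ih (fun j => l j.succ) (fun j => hl _)
      (ψ ∘ₗ LinearMap.mulLeft ℂ (X - C (l 0))) ((r + 1) * A) (fun k => by
        rw [LinearMap.comp_apply, LinearMap.mulLeft_apply, ← sub_eq_of_eq_add' (happ k)]
        refine (norm_sub_le _ _).trans ?_
        rw [norm_mul]
        have := mul_le_mul (hl 0) (hA k) (norm_nonneg _) hr0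
        linarith [hA (k + 1)]) (fun q => by
        rw [LinearMap.comp_apply, LinearMap.mulLeft_apply, ← neg_eq_zero, ← map_neg,
          ← h q, Fin.prod_univ_succ]
        congr 1
        ring)
    have hE : 1 ≤ 1 + (r + 1) / (ρ - r) := by
      have : 0 ≤ (r + 1) / (ρ - r) := by positivity
      linarith
    set E := 1 + (r + 1) / (ρ - r) with hEdef
    have hrel : (r + 1) = (E - 1) * (ρ - r) := by
      rw [hEdef]
      field_simp
      ring
    induction k with
    | zero =>
      rw [pow_zero ρ, mul_one]
      exact (hA 0).trans (le_mul_of_one_le_right hA0 (one_le_pow₀ hE))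
    | succ k ihk =>
      have h1 := hψ' k
      rw [LinearMap.comp_apply, LinearMap.mulLeft_apply] at h1
      rw [happ]
      refine (norm_add_le _ _).trans ?_
      rw [norm_mul]
      have h2 := mul_le_mul (hl 0) ihk (norm_nonneg _) hr0
      refine (add_le_add h2 h1).trans ?_
      have hP : 0 ≤ A * E ^ m * ρ ^ k := by positivity
      have : A * E ^ (m + 1) * ρ ^ (k + 1) -
          (r * (A * E ^ (m + 1) * ρ ^ k) + (r + 1) * A * E ^ m * ρ ^ k) =
          (A * E ^ m * ρ ^ k) * (ρ - r) := by
        rw [hrel]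
        ring
      nlinarith [mul_nonneg hP hρ0.le]

lemma norm_hcoeff_le_h2norm {f : ℂ → ℂ} (hf : MemH2 f) (k : ℕ) : ‖hcoeff f k‖ ≤ h2norm f :=
  Real.le_sqrt_of_sq_le (hf.2.le_tsum k fun _ _ => by positivity)

/-- The coefficients of elements of the model space decay geometrically. -/
lemma MemKB.norm_hcoeff_le {r ρ : ℝ} (hr0 : 0 ≤ r) (hr1 : r < 1) (hρ : r < ρ) {m : ℕ}
    {l : Fin m → ℂ} (hl : ∀ j, ‖l j‖ ≤ r) {f : ℂ → ℂ}
    (hf : MemKB (fun z => ∏ j, blaschke (l j) z) f) (k : ℕ) :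
    ‖hcoeff f k‖ ≤ h2norm f * (1 + (r + 1) / (ρ - r)) ^ m * ρ ^ k := by
  let ψ : Polynomial ℂ →ₗ[ℂ] ℂ :=
    { toFun := fun p => h2inner (fun z => p.eval z) f
      map_add' := fun p q => by
        simp only [Polynomial.eval_add]
        exact h2inner_add_left (.polynomial p) (.polynomial q) hf.1
      map_smul' := fun c p => by
        simp only [Polynomial.eval_smul, smul_eq_mul, RingHom.id_apply]
        exact h2inner_const_mul_left c _ f }
  have hX : ∀ k, ‖ψ (Polynomial.X ^ k)‖ = ‖hcoeff f k‖ := fun k => by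
    change ‖h2inner _ f‖ = _
    unfold h2inner
    simp only [hcoeff_polynomial, Polynomial.coeff_X_pow]
    rw [tsum_eq_single k]
    · simp
    · intro j hj
      simp [hj]
  rw [← hX]
  refine norm_functional_X_pow_le hr0 hρ m l hl ψ _
    (fun k => (hX k).trans_le (norm_hcoeff_le_h2norm hf.1 k)) (fun q => ?_) k
  have h := hf.2 _ (MemH2.polynomial ((∏ j, (1 - Polynomial.C (conj (l j)) * Polynomial.X)) * q))
  change h2inner _ f = 0
  rw [← h2inner_conj, ← map_zero conj, ← h]
  congr 1
  refine h2inner_congr (fun _ _ => rfl) fun z hz => ?_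
  simp only [Polynomial.eval_mul, Polynomial.eval_prod, Polynomial.eval_sub, Polynomial.eval_C,
    Polynomial.eval_X, Polynomial.eval_one]
  rw [← mul_assoc, ← prod_mul_distrib]
  congr 1
  refine prod_congr rfl fun j _ => ?_
  have : 1 - conj (l j) * z ≠ 0 :=
    one_sub_mul_ne_zero (by rw [RCLike.norm_conj]; exact (hl j).trans_lt hr1) hz
  rw [blaschke, div_mul_cancel₀ _ this]

/-- Differentiation is bounded on model spaces, uniformly in the zeros of the Blaschke product. -/
lemma exists_h2norm_deriv_le (n : ℕ) {r : ℝ} (hr0 : 0 ≤ r) (hr1 : r < 1) :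
    ∃ M : ℝ, 0 ≤ M ∧ ∀ m ≤ n, ∀ l : Fin m → ℂ, (∀ j, ‖l j‖ ≤ r) → ∀ f : ℂ → ℂ,
      MemKB (fun z => ∏ j, blaschke (l j) z) f → h2norm f ≤ 1 → h2norm (deriv f) ≤ M := by
  obtain ⟨ρ, hρ, hρ1⟩ := exists_between hr1
  have hρ0 : 0 ≤ ρ := hr0.trans hρ.le
  have hρr : 0 < ρ - r := by linarith
  set E := 1 + (r + 1) / (ρ - r)
  have hE : 1 ≤ E := le_add_of_nonneg_right (by positivity)
  have hE0 : 0 ≤ E := zero_le_one.trans hE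
  have hs : Summable fun k : ℕ => (((k + 1 : ℕ) : ℝ) * (E ^ n * ρ ^ (k + 1))) ^ 2 := by
    have h1 : Summable fun k : ℕ => (k : ℝ) ^ 2 * (ρ ^ 2) ^ k :=
      summable_pow_mul_geometric_of_norm_lt_one 2 (by
        rw [Real.norm_of_nonneg (by positivity)]
        nlinarith)
    have h2 := ((summable_nat_add_iff 1).mpr h1).mul_left ((E ^ n) ^ 2)
    refine h2.congr fun k => ?_
    ring
  refine ⟨Real.sqrt (∑' k : ℕ, (((k + 1 : ℕ) : ℝ) * (E ^ n * ρ ^ (k + 1))) ^ 2),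
    Real.sqrt_nonneg _, fun m hm l hl f hf hf1 => Real.sqrt_le_sqrt ?_⟩
  have hle : ∀ k, ‖hcoeff (deriv f) k‖ ^ 2 ≤ (((k + 1 : ℕ) : ℝ) * (E ^ n * ρ ^ (k + 1))) ^ 2 :=
    fun k => by
      have h := hf.norm_hcoeff_le hr0 hr1 hρ hl (k + 1)
      have h' : ‖hcoeff f (k + 1)‖ ≤ E ^ n * ρ ^ (k + 1) := by
        refine h.trans ?_
        gcongr
        calc h2norm f * E ^ m ≤ 1 * E ^ n := by gcongr
          _ = E ^ n := one_mul _
      have hk : ‖(k : ℂ) + 1‖ = ((k + 1 : ℕ) : ℝ) := by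
        rw [← Nat.cast_succ, Complex.norm_natCast]
      rw [hcoeff_deriv, norm_mul, hk]
      gcongr
  exact (Summable.of_nonneg_of_le (fun _ => by positivity) hle hs).tsum_le_tsum hle hs

lemma DNorm_le {B : ℂ → ℂ} {M : ℝ} (hM : 0 ≤ M)
    (h : ∀ f, MemKB B f → h2norm f ≤ 1 → h2norm (deriv f) ≤ M) : DNorm B ≤ M :=
  Real.sSup_le (by rintro x ⟨f, hf, hf1, rfl⟩; exact h f hf hf1) hM

lemma h2norm_deriv_le_DNorm {n : ℕ} {r : ℝ} (hr0 : 0 ≤ r) (hr1 : r < 1) {l : Fin n → ℂ}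
    (hl : ∀ j, ‖l j‖ ≤ r) {f : ℂ → ℂ} (hf : MemKB (fun z => ∏ j, blaschke (l j) z) f)
    (hf1 : h2norm f ≤ 1) : h2norm (deriv f) ≤ DNorm (fun z => ∏ j, blaschke (l j) z) := by
  obtain ⟨M, -, hM⟩ := exists_h2norm_deriv_le n hr0 hr1
  refine le_csSup ⟨M, ?_⟩ ⟨f, hf, hf1, rfl⟩
  rintro x ⟨g, hg, hg1, rfl⟩
  exact hM n le_rfl l hl g hg hg1

lemma DNorm_le_Cnr {n : ℕ} (hn : 1 ≤ n) {r : ℝ} (hr0 : 0 ≤ r) (hr1 : r < 1) {l : Fin n → ℂ}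
    (hl : ∀ j, ‖l j‖ ≤ r) : DNorm (fun z => ∏ j, blaschke (l j) z) ≤ Cnr n r := by
  obtain ⟨M, hM0, hM⟩ := exists_h2norm_deriv_le n hr0 hr1
  refine le_csSup ⟨M, ?_⟩ ⟨n, hn, le_rfl, l, hl, rfl⟩
  rintro x ⟨m, -, hm, l', hl', rfl⟩
  exact DNorm_le hM0 (hM m hm l' hl')

end Boundedness

section MalmquistWalsh

variable {r : ℝ}

lemma mw_succ (r : ℝ) (k : ℕ) : mw r (k + 1) = fun z =>
    (Real.sqrt (1 - r ^ 2) : ℂ) * (blaschke r z ^ k * (1 / (1 - (r : ℂ) * z))) := by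
  funext z
  simp only [mw, Nat.add_sub_cancel]
  ring

lemma one_sub_sq_pos (hr0 : 0 ≤ r) (hr1 : r < 1) : 0 < 1 - r ^ 2 := by nlinarith

lemma memH2_mw_succ (hr0 : 0 ≤ r) (hr1 : r < 1) (k : ℕ) : MemH2 (mw r (k + 1)) := by
  rw [mw_succ]
  exact ((memH2_szego hr0 hr1).blaschke_pow_mul hr0 hr1 k).const_mul _

lemma h2norm_mw_succ (hr0 : 0 ≤ r) (hr1 : r < 1) (k : ℕ) : h2norm (mw r (k + 1)) = 1 := by
  have hp := one_sub_sq_pos hr0 hr1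
  have h : h2inner (mw r (k + 1)) (mw r (k + 1)) = 1 := by
    rw [mw_succ, h2inner_const_mul_left, ← h2inner_conj, h2inner_const_mul_left,
      h2inner_blaschke_pow_mul hr0 hr1 k (memH2_szego hr0 hr1) (memH2_szego hr0 hr1),
      h2inner_szego_self hr0 hr1, map_mul, conj_ofReal, map_inv₀, conj_ofReal, ← mul_assoc,
      ← ofReal_mul, Real.mul_self_sqrt hp.le, mul_inv_cancel₀ (ofReal_ne_zero.mpr hp.ne')]
  rw [h2inner_self] at h
  exact (pow_eq_one_iff_of_nonneg (Real.sqrt_nonneg _) two_ne_zero).mp (by exact_mod_cast h)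

lemma memKB_mw_succ (hr0 : 0 ≤ r) (hr1 : r < 1) (k : ℕ) :
    MemKB (fun z => blaschke r z ^ (k + 1)) (mw r (k + 1)) := by
  refine ⟨memH2_mw_succ hr0 hr1 k, fun g hg => ?_⟩
  have : (fun z => blaschke r z ^ (k + 1) * g z) =
      fun z => blaschke r z ^ k * (blaschke r z * g z) := by
    funext z
    ring
  rw [mw_succ, this, h2inner_const_mul_left,
    h2inner_blaschke_pow_mul hr0 hr1 k (memH2_szego hr0 hr1) (hg.blaschke_mul hr0 hr1),
    h2inner_szego_blaschke_mul hr0 hr1 hg, mul_zero]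

/-- The derivative of the last Malmquist–Walsh function of `K_{b_r^n}`, expanded in
that basis. -/
lemma deriv_mw (hr0 : 0 ≤ r) (hr1 : r < 1) (k : ℕ) :
    Set.EqOn (deriv (mw r (k + 2))) (fun z =>
      ((Real.sqrt (1 - r ^ 2) / (1 - r ^ 2) : ℝ) : ℂ) * (blaschke r z ^ k *
        (((-(k + 1) : ℝ) : ℂ) * (1 / (1 - (r : ℂ) * z)) + blaschke r z *
          ((((2 * k + 3) * r : ℝ) : ℂ) * (1 / (1 - (r : ℂ) * z)) + blaschke r z *
            (((-((k + 2) * r ^ 2) : ℝ) : ℂ) * (1 / (1 - (r : ℂ) * z))))))) (ball 0 1) := by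
  intro z hz
  have hne : 1 - (r : ℂ) * z ≠ 0 := one_sub_mul_ne_zero (norm_ofReal_lt_one hr0 hr1) hz
  have hp : (1 - (r : ℂ) ^ 2) ≠ 0 := by exact_mod_cast (one_sub_sq_pos hr0 hr1).ne'
  have hl : HasDerivAt (fun z : ℂ => 1 - (r : ℂ) * z) (-(r : ℂ)) z := by
    simpa using ((hasDerivAt_id z).const_mul (r : ℂ)).const_sub 1
  have hb : HasDerivAt (fun z => blaschke (r : ℂ) z)
      ((-1 * (1 - (r : ℂ) * z) - (r - z) * -(r : ℂ)) / (1 - (r : ℂ) * z) ^ 2) z := by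
    simp only [blaschke, conj_ofReal]
    exact ((hasDerivAt_id z).const_sub _).div hl hne
  have hd := (((hasDerivAt_const z (1 : ℂ)).fun_div hl hne).fun_mul (hb.fun_pow (k + 1))).const_mul
    (Real.sqrt (1 - r ^ 2) : ℂ)
  have he : mw r (k + 2) = fun z => (Real.sqrt (1 - r ^ 2) : ℂ) *
      ((1 / (1 - (r : ℂ) * z)) * blaschke r z ^ (k + 1)) := by
    rw [mw_succ]
    funext z
    ring
  rw [he]
  refine hd.deriv.trans ?_
  push_cast
  simp only [pow_succ (blaschke r z) k]
  generalize blaschke (r : ℂ) z ^ k = P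
  simp only [blaschke, conj_ofReal]
  field_simp
  ring

lemma h2norm_deriv_mw_sq (hr0 : 0 ≤ r) (hr1 : r < 1) (k : ℕ) :
    h2norm (deriv (mw r (k + 2))) ^ 2 =
      ((k + 1) ^ 2 + (2 * k + 3) ^ 2 * r ^ 2 + (k + 2) ^ 2 * r ^ 4) / (1 - r ^ 2) ^ 2 := by
  have hp := one_sub_sq_pos hr0 hr1
  have hu := memH2_szego hr0 hr1
  have h0 := hu.const_mul ((-((k + 2) * r ^ 2) : ℝ) : ℂ)
  have h1 := (hu.const_mul (((2 * k + 3) * r : ℝ) : ℂ)).add (h0.blaschke_mul hr0 hr1)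
  have h2 := (hu.const_mul ((-(k + 1) : ℝ) : ℂ)).add (h1.blaschke_mul hr0 hr1)
  rw [← ofReal_inj, ← h2inner_self, h2inner_congr (deriv_mw hr0 hr1 k) (deriv_mw hr0 hr1 k),
    h2inner_const_mul_left, ← h2inner_conj, h2inner_const_mul_left,
    h2inner_blaschke_pow_mul hr0 hr1 k h2 h2, h2inner_szego_add_self hr0 hr1 _ h1,
    h2inner_szego_add_self hr0 hr1 _ h0, h2inner_const_mul_left, ← h2inner_conj,
    h2inner_const_mul_left, h2inner_szego_self hr0 hr1]
  simp only [map_mul, map_add, map_pow, map_inv₀, conj_ofReal]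
  simp only [← ofReal_mul, ← ofReal_add, ← ofReal_pow, ← ofReal_inv, ofReal_inj]
  have hsq := Real.mul_self_sqrt hp.le
  generalize Real.sqrt (1 - r ^ 2) = s at *
  rw [← mul_assoc, ← mul_div_mul_comm, hsq]
  field_simp
  ring

end MalmquistWalsh

/-- For `n ≥ 2` and `0 ≤ r < 1`, the norm of the differentiation
operator on `K_{b_r^n}` is at least
`(n/((1-r)(1+r)))·(1 + 5r⁴ - 4r⁴/n - min(3/4, 2/n))^{1/2}`; consequently
`C_{n,r} ≥ a(n,r)·n/(1-r)` with `a(n,r) = (1/(1+r))·(1 + 5r⁴ - 4r⁴/n - min(3/4, 2/n))^{1/2}`. -/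
theorem stmt2 (n : ℕ) (hn : 2 ≤ n) (r : ℝ) (hr0 : 0 ≤ r) (hr1 : r < 1) :
    DNorm (fun z => (blaschke (r : ℂ) z) ^ n) ≥
      ((n : ℝ) / ((1 - r) * (1 + r))) *
        Real.sqrt (1 + 5 * r ^ 4 - 4 * r ^ 4 / (n : ℝ) - min (3 / 4 : ℝ) (2 / (n : ℝ))) ∧
    Cnr n r ≥
      ((1 / (1 + r)) *
        Real.sqrt (1 + 5 * r ^ 4 - 4 * r ^ 4 / (n : ℝ) - min (3 / 4 : ℝ) (2 / (n : ℝ)))) *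
        ((n : ℝ) / (1 - r)) := by
  have hl : ∀ _ : Fin n, ‖(r : ℂ)‖ ≤ r := fun _ => by
    rw [Complex.norm_real, Real.norm_of_nonneg hr0]
  have hB : (fun z => ∏ _j : Fin n, blaschke (r : ℂ) z) = fun z => blaschke (r : ℂ) z ^ n := by
    simp
  have hD : DNorm (fun z => blaschke (r : ℂ) z ^ n) ≤ Cnr n r := by
    rw [← hB]
    exact DNorm_le_Cnr (by omega) hr0 hr1 hl
  have hmw : h2norm (deriv (mw r n)) ≤ DNorm (fun z => blaschke (r : ℂ) z ^ n) := by
    obtain ⟨k, rfl⟩ := Nat.exists_eq_add_of_le' hn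
    rw [← hB]
    refine h2norm_deriv_le_DNorm hr0 hr1 hl ?_ (h2norm_mw_succ hr0 hr1 (k + 1)).le
    rw [hB]
    exact memKB_mw_succ hr0 hr1 (k + 1)
  have h1 : 0 < (1 - r) * (1 + r) := by nlinarith
  have hlow : ((n : ℝ) / ((1 - r) * (1 + r))) *
        Real.sqrt (1 + 5 * r ^ 4 - 4 * r ^ 4 / (n : ℝ) - min (3 / 4 : ℝ) (2 / (n : ℝ))) ≤
      h2norm (deriv (mw r n)) := by
    have hn0 : (2 : ℝ) ≤ n := by exact_mod_cast hn
    have hsq : h2norm (deriv (mw r n)) ^ 2 =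
        ((n - 1) ^ 2 + (2 * n - 1) ^ 2 * r ^ 2 + n ^ 2 * r ^ 4) / (1 - r ^ 2) ^ 2 := by
      obtain ⟨k, rfl⟩ := Nat.exists_eq_add_of_le' hn
      rw [h2norm_deriv_mw_sq hr0 hr1]
      push_cast
      ring
    have hmin : 2 * (n : ℝ) - 1 ≤ min (3 / 4 : ℝ) (2 / (n : ℝ)) * n ^ 2 := by
      rcases min_choice (3 / 4 : ℝ) (2 / (n : ℝ)) with h | h <;> rw [h]
      · nlinarith
      · have : 2 / (n : ℝ) * n ^ 2 = 2 * n := by field_simp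
        linarith
    rw [← Real.sqrt_sq (show 0 ≤ h2norm (deriv (mw r n)) from Real.sqrt_nonneg _),
      ← Real.sqrt_sq (show 0 ≤ (n : ℝ) / ((1 - r) * (1 + r)) by positivity),
      ← Real.sqrt_mul (sq_nonneg _), hsq]
    refine Real.sqrt_le_sqrt ?_
    have hc : (1 - r) * (1 + r) = 1 - r ^ 2 := by ring
    rw [hc, div_pow, div_mul_eq_mul_div]
    gcongr
    have he : (n : ℝ) ^ 2 * (1 + 5 * r ^ 4 - 4 * r ^ 4 / n - min (3 / 4 : ℝ) (2 / (n : ℝ))) =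
        n ^ 2 * (1 + 5 * r ^ 4) - 4 * r ^ 4 * n - min (3 / 4 : ℝ) (2 / (n : ℝ)) * n ^ 2 := by
      field_simp
    have hr4 : r ^ 4 * (4 * n ^ 2 - 4 * n) ≤ r ^ 2 * (2 * n - 1) ^ 2 := by
      have : r ^ 4 ≤ r ^ 2 := pow_le_pow_of_le_one hr0 hr1.le (by norm_num)
      refine mul_le_mul this ?_ ?_ (by positivity) <;> nlinarith
    rw [he]
    linarith
  have key := hlow.trans hmw
  refine ⟨key, le_trans (le_of_eq ?_) (key.trans hD)⟩
  field_simp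
end
end

section
/- For every r ∈ [0,1), limsup_{n→∞} C_{n,r}/n ≤ (1+r)/(1-r). -/
open Complex Filter Finset MeasureTheory Metric

noncomputable section

/-- The Hardy space in its sequence model `ℓ²(ℕ)`. -/
abbrev SeqH2 : Type := lp (fun _ : ℕ => ℂ) 2

namespace SeqH2

lemma memlp_iff (a : ℕ → ℂ) : Memℓp a 2 ↔ Summable (fun k => ‖a k‖ ^ 2) := by
  rw [memℓp_gen_iff (by norm_num)]
  norm_num

lemma norm_eq_sqrt (a : SeqH2) : ‖a‖ = Real.sqrt (∑' k, ‖a k‖ ^ 2) := by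
  rw [lp.norm_eq_tsum_rpow (by norm_num), Real.sqrt_eq_rpow]
  norm_num

lemma add_apply (a b : SeqH2) (k : ℕ) : (a + b) k = a k + b k := rfl

lemma sub_apply (a b : SeqH2) (k : ℕ) : (a - b) k = a k - b k := rfl

lemma smul_apply (c : ℂ) (a : SeqH2) (k : ℕ) : (c • a) k = c * a k := rfl

/-- The sequence `(0, a 0, a 1, …)`. -/
def shiftSeq (a : ℕ → ℂ) : ℕ → ℂ
  | 0 => 0
  | k + 1 => a k

/-- The unilateral shift, as a linear isometry. -/
def shiftIsometry : SeqH2 →ₗᵢ[ℂ] SeqH2 where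
  toFun a := ⟨shiftSeq a, (memlp_iff _).2 <| (summable_nat_add_iff 1).1 <|
    (memlp_iff _).1 (lp.memℓp a)⟩
  map_add' a b := by
    ext k
    cases k with
    | zero => exact (add_zero (0 : ℂ)).symm
    | succ k => rfl
  map_smul' c a := by
    ext k
    cases k <;> simp [shiftSeq]
  norm_map' a := by
    rw [norm_eq_sqrt, norm_eq_sqrt]
    congr 1
    have h : Summable (fun k => ‖shiftSeq a k‖ ^ 2) :=
      (summable_nat_add_iff 1).1 <| (memlp_iff _).1 (lp.memℓp a)
    exact h.tsum_eq_zero_add.trans (by simp [shiftSeq])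

/-- The unilateral shift, i.e. multiplication by `z`. -/
def shift : SeqH2 →L[ℂ] SeqH2 := shiftIsometry.toContinuousLinearMap

@[simp] lemma shift_zero (a : SeqH2) : shift a 0 = 0 := rfl

@[simp] lemma shift_succ (a : SeqH2) (k : ℕ) : shift a (k + 1) = a k := rfl

lemma norm_shift (a : SeqH2) : ‖shift a‖ = ‖a‖ := shiftIsometry.norm_map a

/-- Multiplication by the denominator `1 - conj(l) z`. -/
def den (l : ℂ) : SeqH2 →L[ℂ] SeqH2 := 1 - (starRingEnd ℂ) l • shift

/-- Multiplication by the numerator `l - z`. -/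
def num (l : ℂ) : SeqH2 →L[ℂ] SeqH2 := l • 1 - shift

/-- Multiplication by `1 / (1 - conj(l) z)`, for `‖l‖ < 1`. -/
def denInv (l : ℂ) : SeqH2 →L[ℂ] SeqH2 := Ring.inverse (den l)

/-- Multiplication by the Blaschke factor, for `‖l‖ < 1`. -/
def blaschkeMul (l : ℂ) : SeqH2 →L[ℂ] SeqH2 := num l * denInv l

lemma den_apply (l : ℂ) (a : SeqH2) : den l a = a - (starRingEnd ℂ) l • shift a := rfl

lemma num_apply (l : ℂ) (a : SeqH2) : num l a = l • a - shift a := rfl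

lemma blaschkeMul_apply (l : ℂ) (a : SeqH2) : blaschkeMul l a = num l (denInv l a) := rfl

variable {l : ℂ}

lemma isUnit_den (hl : ‖l‖ < 1) : IsUnit (den l) := by
  refine isUnit_one_sub_of_norm_lt_one (lt_of_le_of_lt ?_ hl)
  refine ContinuousLinearMap.opNorm_le_bound _ (norm_nonneg _) fun a => ?_
  simp [norm_smul, norm_shift]

lemma den_denInv (hl : ‖l‖ < 1) (a : SeqH2) : den l (denInv l a) = a :=
  congrArg (fun A : SeqH2 →L[ℂ] SeqH2 => A a) (Ring.mul_inverse_cancel _ (isUnit_den hl))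

lemma denInv_den (hl : ‖l‖ < 1) (a : SeqH2) : denInv l (den l a) = a :=
  congrArg (fun A : SeqH2 →L[ℂ] SeqH2 => A a) (Ring.inverse_mul_cancel _ (isUnit_den hl))

lemma norm_num_eq_norm_den (a : SeqH2) : ‖num l a‖ = ‖den l a‖ := by
  refine (sq_eq_sq₀ (norm_nonneg _) (norm_nonneg _)).1 ?_
  rw [num_apply, den_apply, norm_sub_sq (𝕜 := ℂ), norm_sub_sq (𝕜 := ℂ), inner_smul_left,
    inner_smul_right, norm_smul, norm_smul, norm_shift, RCLike.norm_conj]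
  ring

lemma norm_blaschkeMul (hl : ‖l‖ < 1) (a : SeqH2) : ‖blaschkeMul l a‖ = ‖a‖ := by
  rw [blaschkeMul_apply, norm_num_eq_norm_den, den_denInv hl]

lemma norm_denInv_le (hl : ‖l‖ < 1) (a : SeqH2) : ‖denInv l a‖ ≤ ‖a‖ / (1 - ‖l‖) := by
  rw [le_div_iff₀ (by linarith)]
  have h := norm_sub_norm_le (denInv l a) ((starRingEnd ℂ) l • shift (denInv l a))
  rw [← den_apply, den_denInv hl, norm_smul, norm_shift, RCLike.norm_conj] at h
  linarith

/-- `d` is the coefficient sequence of the derivative of the series with coefficients `a`. -/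
def IsDeriv (a d : SeqH2) : Prop := ∀ k : ℕ, d k = (k + 1) * a (k + 1)

lemma IsDeriv.add {a b c d : SeqH2} (h : IsDeriv a c) (h' : IsDeriv b d) :
    IsDeriv (a + b) (c + d) := fun k => by
  simp only [add_apply, h k, h' k]
  ring

lemma IsDeriv.num {a d : SeqH2} (h : IsDeriv a d) : IsDeriv (num l a) (num l d - a) := fun k => by
  rw [num_apply, num_apply]
  cases k with
  | zero =>
    simp only [sub_apply, smul_apply, shift_zero, shift_succ, h 0]
    ring
  | succ k =>
    simp only [sub_apply, smul_apply, shift_succ, h k, h (k + 1)]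
    push_cast
    ring

lemma IsDeriv.of_den (hl : ‖l‖ < 1) {a w : SeqH2} (h : IsDeriv (den l a) w) :
    IsDeriv a (denInv l (w + (starRingEnd ℂ) l • a)) := by
  have key := den_denInv hl (w + (starRingEnd ℂ) l • a)
  set d := denInv l (w + (starRingEnd ℂ) l • a)
  rw [den_apply] at key
  intro k
  have hk := congrArg (fun u : SeqH2 => u k) key
  have hw := h k
  rw [den_apply] at hw
  induction k with
  | zero =>
    simp only [sub_apply, add_apply, smul_apply, shift_zero, shift_succ] at hk hw
    push_cast at hw ⊢
    linear_combination hk + hw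
  | succ k ih =>
    have hd := ih (congrArg (fun u : SeqH2 => u k) key) (by rw [h k, den_apply])
    simp only [sub_apply, add_apply, smul_apply, shift_succ] at hk hw
    push_cast at hw ⊢
    linear_combination hk + hw + (starRingEnd ℂ) l * hd

/-- The product rule for multiplication by a Blaschke factor. -/
lemma IsDeriv.blaschkeMul (hl : ‖l‖ < 1) {g d : SeqH2} (h : IsDeriv g d) :
    IsDeriv (blaschkeMul l g)
      (blaschkeMul l d - ((1 - ‖l‖ ^ 2 : ℝ) : ℂ) • denInv l (denInv l g)) := by
  have hd : IsDeriv (den l (denInv l g)) d := by rwa [den_denInv hl]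
  have h1 := (IsDeriv.of_den hl hd).num (l := l)
  rw [blaschkeMul_apply, blaschkeMul_apply]
  convert h1 using 1
  have h2 := den_denInv hl (denInv l g)
  have h3 : (l : ℂ) * (starRingEnd ℂ) l = ((‖l‖ ^ 2 : ℝ) : ℂ) := by
    rw [Complex.mul_conj, Complex.normSq_eq_norm_sq]
  rw [map_add, map_add, map_smul, map_smul, num_apply l (denInv l (denInv l g))]
  rw [den_apply] at h2
  set v := denInv l g
  set u := denInv l v
  rw [← h2, smul_sub, smul_smul, mul_comm _ l, h3]
  push_cast
  module

lemma norm_deriv_blaschke_le {r : ℝ} (hr : r < 1) (hl : ‖l‖ ≤ r) (g : SeqH2) :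
    ‖((1 - ‖l‖ ^ 2 : ℝ) : ℂ) • denInv l (denInv l g)‖ ≤ (1 + r) / (1 - r) * ‖g‖ := by
  have hl1 : ‖l‖ < 1 := hl.trans_lt hr
  have h0 : 0 < 1 - ‖l‖ := by linarith
  have hp : 0 ≤ 1 - ‖l‖ ^ 2 := by nlinarith [norm_nonneg l]
  rw [norm_smul, Complex.norm_real, Real.norm_of_nonneg hp]
  calc (1 - ‖l‖ ^ 2) * ‖denInv l (denInv l g)‖
      ≤ (1 - ‖l‖ ^ 2) * (‖g‖ / (1 - ‖l‖) / (1 - ‖l‖)) := by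
        gcongr
        exact (norm_denInv_le hl1 _).trans (by gcongr; exact norm_denInv_le hl1 _)
    _ = (1 + ‖l‖) / (1 - ‖l‖) * ‖g‖ := by field_simp; ring
    _ ≤ (1 + r) / (1 - r) * ‖g‖ := by
        have : 0 ≤ 1 + r := by linarith [norm_nonneg l]
        gcongr

/-- The kernel of the adjoint of `blaschkeMul l` consists of geometric sequences. -/
lemma succ_eq_of_orthogonal (hl : ‖l‖ < 1) {x : SeqH2}
    (h : ∀ y, inner ℂ x (blaschkeMul l y) = 0) (k : ℕ) :
    x (k + 1) = (starRingEnd ℂ) l * x k := by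
  have hs : shift (lp.single 2 k (1 : ℂ)) = lp.single 2 (k + 1) (1 : ℂ) := by
    ext j
    cases j with
    | zero => simp [lp.single_apply]
    | succ j => simp [lp.single_apply, Pi.single_apply]
  have h1 := h (den l (lp.single 2 k (1 : ℂ)))
  rw [blaschkeMul_apply, denInv_den hl, num_apply, hs, inner_sub_right, inner_smul_right,
    lp.inner_single_right, lp.inner_single_right] at h1
  have h2 := congrArg (starRingEnd ℂ) h1
  simp at h2
  linear_combination -h2

/-- Multiplication by the finite Blaschke product with zeros `l`. -/
def blaschkeProdMul {m : ℕ} (l : Fin m → ℂ) : SeqH2 →L[ℂ] SeqH2 :=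
  (List.ofFn fun j => blaschkeMul (l j)).prod

lemma blaschkeProdMul_succ {m : ℕ} (l : Fin (m + 1) → ℂ) (a : SeqH2) :
    blaschkeProdMul l a = blaschkeMul (l 0) (blaschkeProdMul (fun j => l j.succ) a) := by
  rw [blaschkeProdMul, List.ofFn_succ, List.prod_cons]
  rfl

/-- The Bernstein-type inequality on a model space. -/
theorem exists_isDeriv_norm_le {r : ℝ} (hr0 : 0 ≤ r) (hr : r < 1) {m : ℕ} (l : Fin m → ℂ)
    (hl : ∀ j, ‖l j‖ ≤ r) (f : SeqH2) (hf : ∀ h, inner ℂ (blaschkeProdMul l h) f = 0) :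
    ∃ d, IsDeriv f d ∧ ‖d‖ ≤ (Real.sqrt m / (1 - r) + m * ((1 + r) / (1 - r))) * ‖f‖ := by
  have h1r : 0 < 1 - r := by linarith
  induction m generalizing f with
  | zero =>
    have h0 : f = 0 := inner_self_eq_zero.1 (hf f)
    subst h0
    exact ⟨0, fun k => by simp, by simp⟩
  | succ m ih =>
    set c := l 0
    have hcr : ‖c‖ ≤ r := hl 0
    have hc : ‖c‖ < 1 := hcr.trans_lt hr
    set g := (blaschkeMul c).adjoint f with hg
    set x := f - blaschkeMul c g with hx
    have hfx : f = x + blaschkeMul c g := by rw [hx]; abel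
    have hiso : (blaschkeMul c).adjoint * blaschkeMul c = 1 :=
      (ContinuousLinearMap.norm_map_iff_adjoint_comp_self _).1 (norm_blaschkeMul hc)
    have hxo : ∀ y, inner ℂ x (blaschkeMul c y) = 0 := fun y => by
      rw [← ContinuousLinearMap.adjoint_inner_left, hx, map_sub, ← hg]
      have := congrArg (fun A : SeqH2 →L[ℂ] SeqH2 => A g) hiso
      simp at this
      simp [this]
    have hnorm : ‖f‖ ^ 2 = ‖x‖ ^ 2 + ‖g‖ ^ 2 := by
      rw [hfx, norm_add_sq (𝕜 := ℂ), hxo, norm_blaschkeMul hc]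
      simp
    obtain ⟨d, hd, hdn⟩ := ih (fun j => l j.succ) (fun j => hl _) g fun h => by
      rw [hg, ContinuousLinearMap.adjoint_inner_right, ← blaschkeProdMul_succ, hf]
    have hxd : IsDeriv x (denInv c (0 + (starRingEnd ℂ) c • x)) := by
      refine IsDeriv.of_den hc fun k => ?_
      simp [den_apply, sub_apply, smul_apply, succ_eq_of_orthogonal hc hxo k, -lp.coeFn_sub]
    refine ⟨_, hfx ▸ hxd.add (hd.blaschkeMul hc), ?_⟩
    have hb1 : ‖denInv c (0 + (starRingEnd ℂ) c • x)‖ ≤ ‖x‖ / (1 - r) := by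
      refine (norm_denInv_le hc _).trans ?_
      rw [zero_add, norm_smul, RCLike.norm_conj]
      gcongr
      exact mul_le_of_le_one_left (norm_nonneg _) hc.le
    have hb2 := norm_deriv_blaschke_le hr hcr g
    have hgf : ‖g‖ ≤ ‖f‖ := (sq_le_sq₀ (norm_nonneg _) (norm_nonneg _)).1 (by nlinarith [sq_nonneg ‖x‖])
    have hcs : ‖x‖ + Real.sqrt m * ‖g‖ ≤ Real.sqrt (m + 1) * ‖f‖ := by
      refine (sq_le_sq₀ (by positivity) (by positivity)).1 ?_
      rw [mul_pow, Real.sq_sqrt (by positivity), hnorm]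
      nlinarith [sq_nonneg (Real.sqrt m * ‖x‖ - ‖g‖), Real.sq_sqrt (Nat.cast_nonneg (α := ℝ) m)]
    set R := (1 + r) / (1 - r) with hR
    have hR0 : 0 ≤ R := by positivity
    calc _ ≤ ‖x‖ / (1 - r) + (‖d‖ + R * ‖g‖) := by
          refine (norm_add_le _ _).trans (add_le_add hb1 ((norm_sub_le _ _).trans ?_))
          rw [norm_blaschkeMul hc]
          gcongr
      _ ≤ ‖x‖ / (1 - r) + ((Real.sqrt m / (1 - r) + m * R) * ‖g‖ + R * ‖g‖) := by gcongr
      _ = (‖x‖ + Real.sqrt m * ‖g‖) / (1 - r) + (m + 1) * R * ‖g‖ := by ring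
      _ ≤ (Real.sqrt (m + 1) * ‖f‖) / (1 - r) + (m + 1) * R * ‖f‖ := by gcongr
      _ = _ := by push_cast; ring

/-- `g` is the sum on the unit disc of the power series with coefficients `a`. -/
def IsSumOn (g : ℂ → ℂ) (a : SeqH2) : Prop :=
  ∀ z ∈ ball (0 : ℂ) 1, HasSum (fun k => a k * z ^ k) (g z)

lemma summable_mul_pow (a : SeqH2) {z : ℂ} (hz : z ∈ ball (0 : ℂ) 1) :
    Summable (fun k => a k * z ^ k) := by
  rw [mem_ball_zero_iff] at hz
  refine Summable.of_norm_bounded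
    ((summable_geometric_of_lt_one (norm_nonneg z) hz).mul_left ‖a‖) fun k => ?_
  rw [norm_mul, norm_pow]
  gcongr
  exact lp.norm_apply_le_norm (by norm_num) a k

lemma isSumOn_tsum (a : SeqH2) : IsSumOn (fun z => ∑' k, a k * z ^ k) a :=
  fun _ hz => (summable_mul_pow a hz).hasSum

lemma IsSumOn.hasFPowerSeriesOnBall {g : ℂ → ℂ} {a : SeqH2} (h : IsSumOn g a) :
    HasFPowerSeriesOnBall g (FormalMultilinearSeries.ofScalars ℂ (a : ℕ → ℂ)) 0 1 where
  r_le := by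
    refine ENNReal.le_of_forall_nnreal_lt fun ρ hρ => ?_
    refine FormalMultilinearSeries.le_radius_of_summable_norm _ ?_
    have hz : ((ρ : ℝ) : ℂ) ∈ ball (0 : ℂ) 1 := by
      have : ρ < 1 := by exact_mod_cast hρ
      simpa using this
    refine (summable_mul_pow a hz).norm.congr fun k => ?_
    simp
  r_pos := one_pos
  hasSum {z} hz := by
    have hz' : z ∈ ball (0 : ℂ) 1 := by
      have h1 : ‖z‖₊ < 1 := by simpa [enorm_eq_nnnorm] using hz
      rw [mem_ball_zero_iff]
      exact_mod_cast h1
    simpa [FormalMultilinearSeries.ofScalars_apply_eq, mul_comm] using h z hz'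

lemma IsSumOn.hcoeff {g : ℂ → ℂ} {a : SeqH2} (h : IsSumOn g a) (k : ℕ) : hcoeff g k = a k := by
  have h1 := h.hasFPowerSeriesOnBall.hasFPowerSeriesAt
  have h2 := h1.analyticAt.hasFPowerSeriesAt
  have h3 := congrArg (fun p => FormalMultilinearSeries.coeff p k) (h1.eq_formalMultilinearSeries h2)
  simp [FormalMultilinearSeries.coeff_ofScalars] at h3
  rw [_root_.hcoeff, h3]

lemma IsSumOn.memH2 {g : ℂ → ℂ} {a : SeqH2} (h : IsSumOn g a) : MemH2 g := by
  refine ⟨?_, ?_⟩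
  · have := h.hasFPowerSeriesOnBall.differentiableOn
    simpa [← ENNReal.ofReal_one, Metric.eball_ofReal] using this
  · simp only [h.hcoeff]
    exact (memlp_iff _).1 (lp.memℓp a)

lemma IsSumOn.sub {g h : ℂ → ℂ} {a b : SeqH2} (hg : IsSumOn g a) (hh : IsSumOn h b) :
    IsSumOn (fun z => g z - h z) (a - b) := fun z hz => by
  simpa [sub_mul] using (hg z hz).sub (hh z hz)

lemma IsSumOn.const_smul {g : ℂ → ℂ} {a : SeqH2} (c : ℂ) (hg : IsSumOn g a) :
    IsSumOn (fun z => c * g z) (c • a) := fun z hz => by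
  simpa [mul_assoc] using (hg z hz).mul_left c

lemma IsSumOn.shift {g : ℂ → ℂ} {a : SeqH2} (hg : IsSumOn g a) :
    IsSumOn (fun z => z * g z) (shift a) := fun z hz => by
  refine (hasSum_nat_add_iff' 1).1 ?_
  simpa [pow_succ', mul_left_comm] using (hg z hz).mul_left z

lemma IsSumOn.blaschkeMul {g : ℂ → ℂ} {a : SeqH2} (hl : ‖l‖ < 1) (hg : IsSumOn g a) :
    IsSumOn (fun z => blaschke l z * g z) (blaschkeMul l a) := by
  have hv := isSumOn_tsum (denInv l a)
  set v := denInv l a with hvd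
  set V : ℂ → ℂ := fun z => ∑' k, v k * z ^ k
  have hden := hv.sub (hv.shift.const_smul ((starRingEnd ℂ) l))
  rw [← den_apply, hvd, den_denInv hl] at hden
  have hnum := (hv.const_smul l).sub hv.shift
  rw [← num_apply, hvd, ← blaschkeMul_apply] at hnum
  intro z hz
  have h0 : 1 - (starRingEnd ℂ) l * z ≠ 0 := fun h => by
    have h1 : ‖(starRingEnd ℂ) l * z‖ = 1 := by rw [← sub_eq_zero.1 h, norm_one]
    rw [norm_mul, RCLike.norm_conj] at h1
    rw [mem_ball_zero_iff] at hz
    nlinarith [norm_nonneg l, norm_nonneg z]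
  have h1 : blaschke l z * g z = l * V z - z * V z := by
    rw [(hg z hz).unique (hden z hz), blaschke, div_mul_eq_mul_div, div_eq_iff h0]
    ring
  simpa only [h1] using hnum z hz

lemma IsSumOn.blaschkeProdMul {m : ℕ} {l : Fin m → ℂ} (hl : ∀ j, ‖l j‖ < 1) {g : ℂ → ℂ}
    {a : SeqH2} (hg : IsSumOn g a) :
    IsSumOn (fun z => (∏ j, blaschke (l j) z) * g z) (blaschkeProdMul l a) := by
  induction m with
  | zero => simpa [SeqH2.blaschkeProdMul] using hg
  | succ m ih =>
    rw [blaschkeProdMul_succ]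
    simpa only [Fin.prod_univ_succ, mul_assoc] using
      (ih fun j => hl j.succ).blaschkeMul (hl 0)

end SeqH2

open SeqH2 in
lemma h2norm_deriv_le {r : ℝ} (hr0 : 0 ≤ r) (hr : r < 1) {m : ℕ} (l : Fin m → ℂ)
    (hl : ∀ j, ‖l j‖ ≤ r) {f : ℂ → ℂ} (hf : MemKB (fun z => ∏ j, blaschke (l j) z) f) :
    h2norm (deriv f) ≤ (Real.sqrt m / (1 - r) + m * ((1 + r) / (1 - r))) * h2norm f := by
  let a : SeqH2 := ⟨hcoeff f, (memlp_iff _).2 hf.1.2⟩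
  have ha : ∀ k, a k = hcoeff f k := fun _ => rfl
  obtain ⟨d, hd, hdn⟩ := exists_isDeriv_norm_le hr0 hr l hl a fun h => by
    have h1 := hf.2 _ (isSumOn_tsum h).memH2
    have h2 := (isSumOn_tsum h).blaschkeProdMul fun j => (hl j).trans_lt hr
    rw [lp.inner_eq_tsum, ← h1, h2inner]
    refine tsum_congr fun k => ?_
    rw [h2.hcoeff, ← ha]
    rfl
  have hdk : ∀ k, hcoeff (deriv f) k = d k := fun k => by
    rw [hd k, ha, hcoeff, hcoeff, iteratedDeriv_succ', Nat.factorial_succ]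
    push_cast
    have : (k : ℂ) + 1 ≠ 0 := by exact_mod_cast k.succ_ne_zero
    have : (Nat.factorial k : ℂ) ≠ 0 := by exact_mod_cast k.factorial_ne_zero
    field_simp
  rw [norm_eq_sqrt, norm_eq_sqrt] at hdn
  simpa only [h2norm, hdk] using hdn

lemma h2norm_nonneg (f : ℂ → ℂ) : 0 ≤ h2norm f := Real.sqrt_nonneg _

lemma DNorm_nonneg (B : ℂ → ℂ) : 0 ≤ DNorm B :=
  Real.sSup_nonneg fun _ ⟨_, _, _, hx⟩ => hx ▸ h2norm_nonneg _

lemma Cnr_nonneg (n : ℕ) (r : ℝ) : 0 ≤ Cnr n r :=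
  Real.sSup_nonneg fun _ ⟨_, _, _, _, _, hx⟩ => hx ▸ DNorm_nonneg _

lemma Cnr_le (n : ℕ) {r : ℝ} (hr0 : 0 ≤ r) (hr : r < 1) :
    Cnr n r ≤ Real.sqrt n / (1 - r) + n * ((1 + r) / (1 - r)) := by
  have h1r : 0 < 1 - r := by linarith
  refine Real.sSup_le ?_ (by positivity)
  rintro _ ⟨m, -, hmn, l, hl, rfl⟩
  have hmn' : (m : ℝ) ≤ n := by exact_mod_cast hmn
  refine Real.sSup_le ?_ (by positivity)
  rintro _ ⟨f, hf, hf1, rfl⟩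
  calc h2norm (deriv f)
      ≤ (Real.sqrt m / (1 - r) + m * ((1 + r) / (1 - r))) * h2norm f :=
        h2norm_deriv_le hr0 hr l hl hf
    _ ≤ Real.sqrt m / (1 - r) + m * ((1 + r) / (1 - r)) :=
        mul_le_of_le_one_right (by positivity) hf1
    _ ≤ _ := by gcongr

/-- For every `r ∈ [0,1)`, `limsup_{n→∞} C_{n,r}/n ≤ (1+r)/(1-r)`. -/
theorem stmt4 (r : ℝ) (hr0 : 0 ≤ r) (hr1 : r < 1) :
    limsup (fun n : ℕ => Cnr n r / n) atTop ≤ (1 + r) / (1 - r) := by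
  have hlim : Tendsto (fun n : ℕ => (Real.sqrt n)⁻¹ / (1 - r) + (1 + r) / (1 - r)) atTop
      (nhds ((1 + r) / (1 - r))) := by
    have h := tendsto_inv_atTop_zero.comp
      (Real.tendsto_sqrt_atTop.comp (tendsto_natCast_atTop_atTop (R := ℝ)))
    simpa using (h.div_const (1 - r)).add_const ((1 + r) / (1 - r))
  rw [← hlim.limsup_eq]
  refine limsup_le_limsup ?_ ?_ hlim.isBoundedUnder_le
  · filter_upwards [eventually_gt_atTop 0] with n hn
    have hn' : (0 : ℝ) < n := by exact_mod_cast hn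
    rw [div_le_iff₀ hn']
    refine (Cnr_le n hr0 hr1).trans (le_of_eq ?_)
    have hs : (Real.sqrt n)⁻¹ * n = Real.sqrt n := by
      rw [inv_mul_eq_div, Real.div_sqrt]
    rw [add_mul, div_mul_eq_mul_div, hs]
    ring
  · refine IsBoundedUnder.isCoboundedUnder_le
      ⟨0, eventually_map.2 (Eventually.of_forall fun n => ?_)⟩
    exact div_nonneg (Cnr_nonneg n r) n.cast_nonneg
end
end
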